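/- Let L ≥ 1, let τ : ℝ → ℝ satisfy |τ(x)| ≤ C_σ for all x, let P_in, P_bd ∈ ℝ^{n×n} with ‖P_in‖_F + ‖P_bd‖_F ≤ B_P, and for each t ∈ ℕ and ℓ ∈ {1,…,L} let W^(t,ℓ) ∈ ℝ^{d_{ℓ-1}×d_ℓ} with ‖W^(t,ℓ)‖_F ≤ B_W and let Z̃^(t,ℓ) ∈ ℝ^{n×d_ℓ}. Suppose the family J̃^(t,ℓ) of matrices satisfies ‖J̃^(t,L)‖_F ≤ C_loss for all t, J̃^(t,ℓ-1) = P_inᵀ (J̃^(t,ℓ) ∘ τ(Z̃^(t,ℓ))) (W^(t,ℓ))ᵀ + P_bdᵀ (J̃^(t-1,ℓ) ∘ τ(Z̃^(t-1,ℓ))) (W^(t-1,ℓ))ᵀ for all t ≥ 1 and ℓ ∈ {2,…,L}, and ‖J̃^(0,ℓ)‖_F ≤ (C_σ B_P B_W)^{L−ℓ} C_loss for all ℓ. Then for every t ≥ 0 and ℓ ∈ {1,…,L}, ‖J̃^(t,ℓ)‖_F ≤ (C_σ B_P B_W)^{L−ℓ} C_loss. -/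

import Mathlib

open Matrix

attribute [local instance] Matrix.frobeniusNormedAddCommGroup

/-- Hadamard multiplication by a matrix with entries bounded by `C` scales the Frobenius norm by at
most `C`. -/
theorem frobenius_norm_hadamard_le {m n : Type*} [Fintype m] [Fintype n] {C : ℝ} (hC : 0 ≤ C)
    (A B : Matrix m n ℝ) (hB : ∀ i j, |B i j| ≤ C) : ‖A ⊙ B‖ ≤ C * ‖A‖ := by
  have hsq (M : Matrix m n ℝ) : ‖M‖ = √(∑ i, ∑ j, M i j ^ 2) := by
    simp [frobenius_norm_def, Real.sqrt_eq_rpow]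
  rw [hsq, hsq, ← Real.sqrt_sq hC, ← Real.sqrt_mul (sq_nonneg C)]
  refine Real.sqrt_le_sqrt ?_
  simp_rw [Finset.mul_sum]
  refine Finset.sum_le_sum fun i _ => Finset.sum_le_sum fun j _ => ?_
  rw [hadamard_apply, mul_pow, mul_comm]
  exact mul_le_mul_of_nonneg_right (sq_le_sq' (abs_le.mp (hB i j)).1 (abs_le.mp (hB i j)).2)
    (sq_nonneg _)

/-- Frobenius norm bound for a single backward propagation step `Pᵀ (J ∘ τ(Z)) Wᵀ`. -/
theorem frobenius_norm_backward_le {n k l : Type*} [Fintype n] [Fintype k] [Fintype l]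
    {τ : ℝ → ℝ} {C b w : ℝ} (hτ : ∀ x, |τ x| ≤ C) (P : Matrix n n ℝ) (J Z : Matrix n k ℝ)
    (W : Matrix l k ℝ) (hJ : ‖J‖ ≤ b) (hW : ‖W‖ ≤ w) :
    ‖Pᵀ * (J ⊙ Z.map τ) * Wᵀ‖ ≤ ‖P‖ * (C * b) * w := by
  have hC : 0 ≤ C := (abs_nonneg _).trans (hτ 0)
  have hb : 0 ≤ b := (norm_nonneg J).trans hJ
  have hH : ‖J ⊙ Z.map τ‖ ≤ C * b :=
    (frobenius_norm_hadamard_le hC J _ fun i j => hτ (Z i j)).trans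
      (mul_le_mul_of_nonneg_left hJ hC)
  calc ‖Pᵀ * (J ⊙ Z.map τ) * Wᵀ‖ ≤ ‖Pᵀ * (J ⊙ Z.map τ)‖ * ‖Wᵀ‖ := frobenius_norm_mul _ _
    _ ≤ ‖Pᵀ‖ * ‖J ⊙ Z.map τ‖ * ‖Wᵀ‖ :=
        mul_le_mul_of_nonneg_right (frobenius_norm_mul _ _) (norm_nonneg _)
    _ = ‖P‖ * ‖J ⊙ Z.map τ‖ * ‖W‖ := by
        rw [frobenius_norm_transpose P, frobenius_norm_transpose W]
    _ ≤ ‖P‖ * (C * b) * w := by gcongr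

/-- Boundedness of the PipeGCN backward-propagated feature gradients `J̃^(t,ℓ)`, which mix
fresh intra-partition gradients (via `Pin`) with one-iteration-stale boundary gradients
(via `Pbd`); `τ` plays the role of the activation derivative `σ'`, `⊙` is the Hadamard
product, and all norms are Frobenius norms. -/
theorem stmt_6 (L n : ℕ) (hL : 1 ≤ L) (d : ℕ → ℕ)
    (τ : ℝ → ℝ) (Cσ : ℝ) (hτ : ∀ x : ℝ, |τ x| ≤ Cσ)
    (BP BW Closs : ℝ)
    (Pin Pbd : Matrix (Fin n) (Fin n) ℝ) (hP : ‖Pin‖ + ‖Pbd‖ ≤ BP)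
    (W : ℕ → (ℓ : ℕ) → Matrix (Fin (d (ℓ - 1))) (Fin (d ℓ)) ℝ)
    (hW : ∀ t ℓ, 1 ≤ ℓ → ℓ ≤ L → ‖W t ℓ‖ ≤ BW)
    (Zt : ℕ → (ℓ : ℕ) → Matrix (Fin n) (Fin (d ℓ)) ℝ)
    (Jt : ℕ → (ℓ : ℕ) → Matrix (Fin n) (Fin (d ℓ)) ℝ)
    (hJL : ∀ t, ‖Jt t L‖ ≤ Closs)
    (hrec : ∀ t, 1 ≤ t → ∀ ℓ, 2 ≤ ℓ → ℓ ≤ L →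
      Jt t (ℓ - 1) = Pinᵀ * (Jt t ℓ ⊙ (Zt t ℓ).map τ) * (W t ℓ)ᵀ
        + Pbdᵀ * (Jt (t - 1) ℓ ⊙ (Zt (t - 1) ℓ).map τ) * (W (t - 1) ℓ)ᵀ)
    (hbase : ∀ ℓ, 1 ≤ ℓ → ℓ ≤ L → ‖Jt 0 ℓ‖ ≤ (Cσ * BP * BW) ^ (L - ℓ) * Closs) :
    ∀ t, ∀ ℓ, 1 ≤ ℓ → ℓ ≤ L → ‖Jt t ℓ‖ ≤ (Cσ * BP * BW) ^ (L - ℓ) * Closs := by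
  intro t ℓ hℓ hℓL
  induction hk : L - ℓ generalizing t ℓ with
  | zero =>
    obtain rfl : ℓ = L := by omega
    simpa using hJL t
  | succ k ih =>
    rcases Nat.eq_zero_or_pos t with rfl | ht
    · exact hk ▸ hbase ℓ hℓ hℓL
    have hJ (s : ℕ) := ih s (ℓ + 1) (by omega) (by omega) (by omega)
    have hWs (s : ℕ) := hW s (ℓ + 1) (by omega) (by omega)
    have hCσ : 0 ≤ Cσ := (abs_nonneg _).trans (hτ 0)
    have hBW : 0 ≤ BW := (norm_nonneg _).trans (hWs t)
    have hb := (norm_nonneg _).trans (hJ t)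
    have hstep : ‖Jt t (ℓ + 1 - 1)‖ ≤ (Cσ * BP * BW) ^ (k + 1) * Closs := by
      rw [hrec t ht (ℓ + 1) (by omega) (by omega)]
      set b := (Cσ * BP * BW) ^ k * Closs with hbdef
      calc _ ≤ ‖Pin‖ * (Cσ * b) * BW + ‖Pbd‖ * (Cσ * b) * BW :=
            norm_add_le_of_le
              (frobenius_norm_backward_le hτ Pin _ _ _ (hJ t) (hWs t))
              (frobenius_norm_backward_le hτ Pbd _ _ _ (hJ (t - 1)) (hWs (t - 1)))
        _ = (‖Pin‖ + ‖Pbd‖) * (Cσ * b) * BW := by ring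
        _ ≤ BP * (Cσ * b) * BW := by gcongr
        _ = (Cσ * BP * BW) ^ (k + 1) * Closs := by rw [hbdef]; ring
    exact hstep
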